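/- Fix N ∈ ℕ and a commutative ring R. In (MvPolynomial (Fin N) R)⟦t⟧, let H(t) = Σ_{k≥0} h_k t^k where h_k is the complete homogeneous symmetric polynomial of degree k, and let P(t) = Σ_{k≥1} p_k t^k where p_k = Σ_{i=1}^{N} x_i^k is the k-th power sum. Then t · H′(t) = H(t) · P(t), where H′ denotes the formal derivative of the power series H with respect to t. -/

import Mathlib

open Finset in
/-- The generating series of the complete homogeneous symmetric polynomials is the product of the
geometric series of the variables. -/
theorem MvPolynomial.mk_hsymm_eq_prod (σ R : Type*) [Fintype σ] [DecidableEq σ] [CommSemiring R] :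
    (PowerSeries.mk fun k => hsymm σ R k) =
      ∏ i : σ, PowerSeries.mk fun k => (X i : MvPolynomial σ R) ^ k := by
  ext1 n
  simp only [PowerSeries.coeff_prod, PowerSeries.coeff_mk, hsymm]
  refine sum_bij (fun s _ => Multiset.toFinsupp s.1) (fun s _ => ?_)
    (fun s _ t _ h => Subtype.ext (Multiset.toFinsupp.injective h)) (fun l hl => ?_)
    (fun s _ => ?_)
  · refine mem_finsuppAntidiag.2 ⟨?_, subset_univ _⟩
    exact (Multiset.sum_count_eq_card fun a _ => mem_univ a).trans s.2
  · refine ⟨⟨Finsupp.toMultiset l, ?_⟩, mem_univ _, Finsupp.toMultiset_toFinsupp l⟩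
    rw [Finsupp.card_toMultiset, Finsupp.sum_fintype _ _ fun _ => rfl]
    exact (mem_finsuppAntidiag.1 hl).1
  · rw [prod_multiset_map_count]
    refine prod_subset (subset_univ _) fun i _ hi => ?_
    rw [Multiset.count_eq_zero.2 (mt Multiset.mem_toFinset.2 hi), pow_zero]

open Finset in
/-- The identity `t·G′(t) = G(t)·Σ_{k≥1} a^k t^k` for the geometric series `G(t) = Σ a^k t^k`. -/
theorem PowerSeries.X_mul_derivative_mk_pow {A : Type*} [CommSemiring A] (a : A) :
    X * derivative A (mk fun k => a ^ k) =
      (mk fun k => a ^ k) * mk fun k => if k = 0 then 0 else a ^ k := by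
  ext n
  cases n with
  | zero => simp
  | succ n =>
    rw [coeff_succ_X_mul, coeff_derivative, coeff_mul, Nat.sum_antidiagonal_succ']
    have h : ∀ p ∈ antidiagonal n, a ^ p.1 * a ^ (p.2 + 1) = a ^ (n + 1) := fun p hp => by
      rw [← pow_add, ← add_assoc, mem_antidiagonal.1 hp]
    simp [sum_congr rfl h, mul_comm]

/-- If `x·D(fᵢ) = fᵢ·gᵢ` for a derivation `D` and all `i`, then `x·D(∏ fᵢ) = (∏ fᵢ)·∑ gᵢ`. -/
theorem Derivation.mul_map_prod_of_forall_mul_map {R A ι : Type*} [CommSemiring R]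
    [CommSemiring A] [Algebra R A] (D : Derivation R A A) {x : A} {f g : ι → A} (s : Finset ι)
    (h : ∀ i ∈ s, x * D (f i) = f i * g i) :
    x * D (∏ i ∈ s, f i) = (∏ i ∈ s, f i) * ∑ i ∈ s, g i := by
  classical
  induction s using Finset.induction_on with
  | empty => simp
  | insert i s hi ih =>
    rw [Finset.prod_insert hi, Finset.sum_insert hi, D.leibniz, smul_eq_mul, smul_eq_mul]
    calc x * (f i * D (∏ j ∈ s, f j) + (∏ j ∈ s, f j) * D (f i))
        = f i * (x * D (∏ j ∈ s, f j)) + (∏ j ∈ s, f j) * (x * D (f i)) := by ring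
      _ = _ := by
        rw [ih fun j hj => h j (Finset.mem_insert_of_mem hj), h i (Finset.mem_insert_self i s)]
        ring

/-- The logarithmic-derivative identity `t·H′(t) = H(t)·P(t)` in
`(MvPolynomial (Fin N) R)⟦t⟧`, where `H(t) = Σ_{k≥0} h_k t^k` is the generating series of
the complete homogeneous symmetric polynomials and `P(t) = Σ_{k≥1} p_k t^k` that of the
power sums. -/
theorem X_mul_derivative_hsymm_series (N : ℕ) (R : Type) [CommRing R] :
    PowerSeries.X * (PowerSeries.mk fun k => MvPolynomial.hsymm (Fin N) R k).derivativeFun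
      = (PowerSeries.mk fun k => MvPolynomial.hsymm (Fin N) R k)
        * PowerSeries.mk fun k =>
            if k = 0 then 0 else MvPolynomial.psum (Fin N) R k := by
  have hP : (PowerSeries.mk fun k => if k = 0 then 0 else MvPolynomial.psum (Fin N) R k) =
      ∑ i : Fin N, PowerSeries.mk fun k =>
        if k = 0 then 0 else (MvPolynomial.X i : MvPolynomial (Fin N) R) ^ k := by
    ext1 n
    by_cases hn : n = 0 <;> simp [hn, MvPolynomial.psum]
  rw [hP, MvPolynomial.mk_hsymm_eq_prod]
  exact (PowerSeries.derivative _).mul_map_prod_of_forall_mul_map _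
    fun i _ => PowerSeries.X_mul_derivative_mk_pow _
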